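/- arXiv:1905.03661 — 3 statements merged into one kernel-verified Lean document; each statement's English description precedes it below -/
import Mathlib

section
/- Let n and e be integers with 0 ≤ e ≤ n, and let g ∈ GL₂(ℚ_p) be such that g·a(p^e)^{−1} ∈ GL₂(ℤ_p). Then there exist an integer ℓ with 0 ≤ ℓ ≤ n and a unit ν ∈ ℤ_p^× such that one of the following holds: (1) ℓ ≤ e and g ∈ Z·N·g_{−e,ℓ,ν}·K^{(1)}(p^n), i.e. g = z(y)·n(x)·g_{−e,ℓ,ν}·κ for some y ∈ ℚ_p^×, x ∈ ℚ_p, κ ∈ K^{(1)}(p^n); or (2) e < ℓ ≤ n and g ∈ Z·N·g_{−2ℓ+e,ℓ,ν}·K^{(1)}(p^n). -/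
noncomputable section

open Matrix

/-- `n(x) = [[1,x],[0,1]]` in `GL₂(ℚ_p)`. -/
def nmat (p : ℕ) [Fact p.Prime] (x : ℚ_[p]) : Matrix (Fin 2) (Fin 2) ℚ_[p] :=
  !![1, x; 0, 1]

/-- `a(y) = [[y,0],[0,1]]`. -/
def amat (p : ℕ) [Fact p.Prime] (y : ℚ_[p]) : Matrix (Fin 2) (Fin 2) ℚ_[p] :=
  !![y, 0; 0, 1]

/-- `z(y) = [[y,0],[0,y]]`. -/
def zmat (p : ℕ) [Fact p.Prime] (y : ℚ_[p]) : Matrix (Fin 2) (Fin 2) ℚ_[p] :=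
  !![y, 0; 0, y]

/-- `w = [[0,1],[-1,0]]`. -/
def wmat (p : ℕ) [Fact p.Prime] : Matrix (Fin 2) (Fin 2) ℚ_[p] :=
  !![0, 1; -1, 0]

/-- The representative `g_{m,ℓ,ν} = a(p^m) w n(p^{-ℓ} ν)`. -/
def gcoset (p : ℕ) [Fact p.Prime] (m : ℤ) (ℓ : ℕ) (ν : ℤ_[p]ˣ) :
    Matrix (Fin 2) (Fin 2) ℚ_[p] :=
  amat p ((p : ℚ_[p]) ^ m) * wmat p *
    nmat p ((p : ℚ_[p]) ^ (-(ℓ : ℤ)) * ((ν : ℤ_[p]) : ℚ_[p]))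

/-- Membership in `GL₂(ℤ_p)`: all entries are `p`-adic integers and the determinant is a
`p`-adic unit. -/
def InGL2Zp (p : ℕ) [Fact p.Prime] (k : Matrix (Fin 2) (Fin 2) ℚ_[p]) : Prop :=
  (∀ i j, ‖k i j‖ ≤ 1) ∧ ‖k.det‖ = 1

/-- Membership in the congruence subgroup `K^{(1)}(p^n) ⊆ GL₂(ℤ_p)`:
`a - 1 ∈ p^n ℤ_p` and `c ∈ p^n ℤ_p`. -/
def K1 (p : ℕ) [Fact p.Prime] (n : ℕ) (k : Matrix (Fin 2) (Fin 2) ℚ_[p]) : Prop :=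
  InGL2Zp p k ∧ ‖k 0 0 - 1‖ ≤ (p : ℝ) ^ (-(n : ℤ)) ∧ ‖k 1 0‖ ≤ (p : ℝ) ^ (-(n : ℤ))

/-- Two invertible matrices with the same bottom row and the same determinant differ by an
upper unipotent matrix on the left; here the second one is `z(y) a(q) w n(t) κ`. -/
lemma exists_eq_zmat_mul_nmat_mul (p : ℕ) [Fact p.Prime]
    (g κ : Matrix (Fin 2) (Fin 2) ℚ_[p]) (y t q : ℚ_[p]) (hg : g.det ≠ 0)
    (h₀ : g 1 0 = -y * (κ 0 0 + t * κ 1 0)) (h₁ : g 1 1 = -y * (κ 0 1 + t * κ 1 1))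
    (hdet : g.det = y ^ 2 * q * κ.det) :
    ∃ x, g = zmat p y * nmat p x * (amat p q * wmat p * nmat p t) * κ := by
  rw [det_fin_two] at hg
  simp only [det_fin_two] at hdet
  have key : ∃ x, g 0 0 = y * q * κ 1 0 + x * g 1 0 ∧ g 0 1 = y * q * κ 1 1 + x * g 1 1 := by
    by_cases hr : g 1 0 = 0
    · have hs : g 1 1 ≠ 0 := fun hs => hg (by rw [hr, hs]; ring)
      refine ⟨(g 0 1 - y * q * κ 1 1) / g 1 1, ?_, by field_simp; ring⟩
      apply mul_right_cancel₀ hs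
      rw [hr, mul_zero, add_zero]
      have h₀' := hr
      rw [h₀] at h₀'
      linear_combination hdet + g 0 1 * hr + y * q * κ 1 0 * (-h₁) - y * q * κ 1 1 * h₀'
    · refine ⟨(g 0 0 - y * q * κ 1 0) / g 1 0, by field_simp; ring, ?_⟩
      field_simp
      linear_combination -hdet + y * q * κ 1 0 * h₁ - y * q * κ 1 1 * h₀
  obtain ⟨x, hx₀, hx₁⟩ := key
  refine ⟨x, ?_⟩
  ext i j
  fin_cases i <;> fin_cases j <;>
    simp [zmat, nmat, amat, wmat, Matrix.mul_apply, Fin.sum_univ_two]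
  · rw [hx₀, h₀]; ring
  · rw [hx₁, h₁]; ring
  · rw [h₀]; ring
  · rw [h₁]; ring

lemma exists_unit_zpow_mul_eq (p : ℕ) [Fact p.Prime] (ℓ : ℕ) (t : ℚ_[p])
    (ht : ‖t‖ = (p : ℝ) ^ (ℓ : ℤ)) :
    ∃ ν : ℤ_[p]ˣ, (p : ℚ_[p]) ^ (-(ℓ : ℤ)) * ((ν : ℤ_[p]) : ℚ_[p]) = t := by
  have hp : (p : ℚ_[p]) ≠ 0 := by exact_mod_cast (Fact.out : p.Prime).ne_zero
  have hp' : (p : ℝ) ≠ 0 := by exact_mod_cast (Fact.out : p.Prime).ne_zero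
  have hu : ‖(p : ℚ_[p]) ^ (ℓ : ℤ) * t‖ = 1 := by
    rw [norm_mul, Padic.norm_p_zpow, ht, ← zpow_add₀ hp', neg_add_cancel, zpow_zero]
  refine ⟨PadicInt.mkUnits hu, ?_⟩
  rw [PadicInt.mkUnits_eq, ← mul_assoc, ← zpow_add₀ hp, neg_add_cancel, zpow_zero, one_mul]

lemma padic_norm_sub_le_max (p : ℕ) [Fact p.Prime] (x y : ℚ_[p]) :
    ‖x - y‖ ≤ max ‖x‖ ‖y‖ := by
  simpa [sub_eq_add_neg] using Padic.nonarchimedean x (-y)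

lemma exists_nat_norm_eq_zpow_neg (p : ℕ) [Fact p.Prime] {r : ℚ_[p]} (hr : r ≠ 0)
    (hr₁ : ‖r‖ ≤ 1) : ∃ k : ℕ, ‖r‖ = (p : ℝ) ^ (-(k : ℤ)) :=
  ⟨_, PadicInt.norm_eq_zpow_neg_valuation (x := ⟨r, hr₁⟩)
    fun h => hr (congrArg Subtype.val h)⟩

lemma K1_upper_triangular (p : ℕ) [Fact p.Prime] (n : ℕ) {x u : ℚ_[p]} (hx : ‖x‖ ≤ 1)
    (hu : ‖u‖ = 1) : K1 p n !![1, x; 0, u] := by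
  refine ⟨⟨fun i j => ?_, by simpa [det_fin_two] using hu⟩, by simp, by simp⟩
  fin_cases i <;> fin_cases j <;> simp [hx, hu.le]

lemma K1_lower_triangular (p : ℕ) [Fact p.Prime] (n : ℕ) {x u : ℚ_[p]}
    (hx : ‖x‖ ≤ (p : ℝ) ^ (-(n : ℤ))) (hu : ‖u‖ = 1) : K1 p n !![1, 0; x, u] := by
  have hx₁ : ‖x‖ ≤ 1 := hx.trans <| zpow_le_one_of_nonpos₀
    (by exact_mod_cast (Fact.out : p.Prime).one_le) (by simp)
  refine ⟨⟨fun i j => ?_, by simpa [det_fin_two] using hu⟩, by simp, by simpa using hx⟩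
  fin_cases i <;> fin_cases j <;> simp [hx₁, hu.le]

/-- `g ∈ Z N g_{m,ℓ,ν} K^{(1)}(p^n)` by means of an upper triangular element of
`K^{(1)}(p^n)`. -/
lemma exists_decomp_of_upper (p : ℕ) [Fact p.Prime] (n ℓ : ℕ) (m : ℤ) (ν : ℤ_[p]ˣ)
    (g : Matrix (Fin 2) (Fin 2) ℚ_[p]) (hg : g.det ≠ 0) (hr : g 1 0 ≠ 0) {u : ℚ_[p]}
    (hu : ‖u‖ = 1) (hdet : g.det = g 1 0 ^ 2 * (p : ℚ_[p]) ^ m * u)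
    (hx : ‖g 1 1 / g 1 0 - (p : ℚ_[p]) ^ (-(ℓ : ℤ)) * ((ν : ℤ_[p]) : ℚ_[p]) * u‖ ≤ 1) :
    ∃ (y x : ℚ_[p]) (κ : Matrix (Fin 2) (Fin 2) ℚ_[p]),
      y ≠ 0 ∧ K1 p n κ ∧ g = zmat p y * nmat p x * gcoset p m ℓ ν * κ := by
  obtain ⟨x, h_eq⟩ := exists_eq_zmat_mul_nmat_mul p g
    !![1, g 1 1 / g 1 0 - (p : ℚ_[p]) ^ (-(ℓ : ℤ)) * ((ν : ℤ_[p]) : ℚ_[p]) * u; 0, u]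
    (-g 1 0) ((p : ℚ_[p]) ^ (-(ℓ : ℤ)) * ((ν : ℤ_[p]) : ℚ_[p])) ((p : ℚ_[p]) ^ m) hg
    (by simp) (by simp; field_simp) (by rw [hdet]; simp [det_fin_two])
  exact ⟨_, x, _, neg_ne_zero.mpr hr, K1_upper_triangular p n hx hu, h_eq⟩

/-- The case of `g ∈ Z N g_{m,ℓ,ν} K^{(1)}(p^n)` where the bottom row and the determinant
of `g` determine `ν`, with a diagonal element of `K^{(1)}(p^n)`. -/
lemma exists_unit_decomp_of_norm (p : ℕ) [Fact p.Prime] (n ℓ : ℕ) (m : ℤ)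
    (g : Matrix (Fin 2) (Fin 2) ℚ_[p]) (hr : g 1 0 ≠ 0)
    (hdet : ‖g.det‖ = ‖g 1 0‖ ^ 2 * (p : ℝ) ^ (-m))
    (hs : ‖g 1 1‖ = ‖g 1 0‖ * (p : ℝ) ^ (ℓ : ℤ)) :
    ∃ (ν : ℤ_[p]ˣ) (y x : ℚ_[p]) (κ : Matrix (Fin 2) (Fin 2) ℚ_[p]),
      y ≠ 0 ∧ K1 p n κ ∧ g = zmat p y * nmat p x * gcoset p m ℓ ν * κ := by
  have hp : (p : ℚ_[p]) ≠ 0 := by exact_mod_cast (Fact.out : p.Prime).ne_zero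
  have hp' : (p : ℝ) ≠ 0 := by exact_mod_cast (Fact.out : p.Prime).ne_zero
  have hr' : ‖g 1 0‖ ≠ 0 := norm_ne_zero_iff.mpr hr
  have hm := zpow_ne_zero m hp
  have hm' := zpow_ne_zero (-m) hp'
  have hu : ‖g.det / (g 1 0 ^ 2 * (p : ℚ_[p]) ^ m)‖ = 1 := by
    rw [norm_div, norm_mul, norm_pow, Padic.norm_p_zpow, hdet]
    exact div_self (mul_ne_zero (pow_ne_zero 2 hr') hm')
  have hg : g.det ≠ 0 := by
    rw [← norm_ne_zero_iff, hdet]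
    exact mul_ne_zero (pow_ne_zero 2 hr') hm'
  obtain ⟨ν, hν⟩ := exists_unit_zpow_mul_eq p ℓ
    (g 1 1 / g 1 0 / (g.det / (g 1 0 ^ 2 * (p : ℚ_[p]) ^ m))) (by
      rw [norm_div, hu, div_one, norm_div, hs]
      field_simp)
  refine ⟨ν, exists_decomp_of_upper p n ℓ m ν g hg hr hu (by field_simp) ?_⟩
  rw [hν, div_mul_cancel₀ _ (norm_ne_zero_iff.mp (by rw [hu]; exact one_ne_zero))]
  simp

/-- If the bottom left entry of `g` is divisible by `p^n` and the bottom right one is a unit, then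
`g ∈ Z N g_{e-2n,n,ν} K^{(1)}(p^n)`. -/
lemma exists_unit_decomp_of_norm_le (p : ℕ) [Fact p.Prime] (n e : ℕ)
    (g : Matrix (Fin 2) (Fin 2) ℚ_[p]) (hdet : ‖g.det‖ = (p : ℝ) ^ (-(e : ℤ)))
    (hr : ‖g 1 0‖ ≤ (p : ℝ) ^ (-(n : ℤ))) (hs : ‖g 1 1‖ = 1) :
    ∃ (ν : ℤ_[p]ˣ) (y x : ℚ_[p]) (κ : Matrix (Fin 2) (Fin 2) ℚ_[p]),
      y ≠ 0 ∧ K1 p n κ ∧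
        g = zmat p y * nmat p x * gcoset p (-2 * (n : ℤ) + (e : ℤ)) n ν * κ := by
  have hp : (p : ℚ_[p]) ≠ 0 := by exact_mod_cast (Fact.out : p.Prime).ne_zero
  have hp' : (p : ℝ) ≠ 0 := by exact_mod_cast (Fact.out : p.Prime).ne_zero
  have hg : g.det ≠ 0 := by
    rw [← norm_ne_zero_iff, hdet]
    exact zpow_ne_zero _ hp'
  have hs₀ : g 1 1 ≠ 0 := norm_ne_zero_iff.mp (by rw [hs]; exact one_ne_zero)
  set D : ℚ_[p] := g.det / (p : ℚ_[p]) ^ (e : ℤ) with hD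
  have hD₁ : ‖D‖ = 1 := by
    rw [hD, norm_div, hdet, Padic.norm_p_zpow, div_self (zpow_ne_zero _ hp')]
  have hD₀ : D ≠ 0 := norm_ne_zero_iff.mp (by rw [hD₁]; exact one_ne_zero)
  have hgD : g.det = D * (p : ℚ_[p]) ^ (e : ℤ) := by
    rw [hD, div_mul_cancel₀ _ (zpow_ne_zero _ hp)]
  set P : ℚ_[p] := (p : ℚ_[p]) ^ (n : ℤ) with hP
  have hP₀ : P ≠ 0 := zpow_ne_zero _ hp
  have hν₁ : ‖g 1 1 / D‖ = 1 := by rw [norm_div, hs, hD₁, div_one]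
  have hn : (p : ℚ_[p]) ^ (-(n : ℤ)) = P⁻¹ := zpow_neg _ _
  have hm : (p : ℚ_[p]) ^ (-2 * (n : ℤ) + (e : ℤ)) = (P ^ 2)⁻¹ * (p : ℚ_[p]) ^ (e : ℤ) := by
    rw [zpow_add₀ hp, hP, ← zpow_natCast, ← _root_.zpow_mul, ← _root_.zpow_neg]
    congr 2
    push_cast
    ring
  obtain ⟨x, hx⟩ := exists_eq_zmat_mul_nmat_mul p g
    !![1, 0; D / g 1 1 * (g 1 0 - P), D] (-P)
    ((p : ℚ_[p]) ^ (-(n : ℤ)) * ((PadicInt.mkUnits hν₁ : ℤ_[p]) : ℚ_[p]))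
    ((p : ℚ_[p]) ^ (-2 * (n : ℤ) + (e : ℤ))) hg
    (by rw [PadicInt.mkUnits_eq, hn]; simp; field_simp; ring)
    (by rw [PadicInt.mkUnits_eq, hn]; simp; field_simp)
    (by rw [hm, hgD]; simp [det_fin_two]; field_simp)
  refine ⟨PadicInt.mkUnits hν₁, -P, x, _, neg_ne_zero.mpr hP₀,
    K1_lower_triangular p n ?_ hD₁, hx⟩
  rw [norm_mul, norm_div, hD₁, hs, div_one, one_mul]
  exact (padic_norm_sub_le_max p (g 1 0) P).trans (max_le hr (Padic.norm_p_zpow (n : ℤ)).le)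

lemma norm_bottom_right_eq_one (p : ℕ) [Fact p.Prime] {k : Matrix (Fin 2) (Fin 2) ℚ_[p]}
    (hk : InGL2Zp p k) (hc : ‖k 1 0‖ < 1) : ‖k 1 1‖ = 1 := by
  obtain ⟨hk₁, hk₂⟩ := hk
  refine le_antisymm (hk₁ 1 1) (not_lt.mp fun hd => ?_)
  rw [det_fin_two] at hk₂
  refine absurd hk₂ (ne_of_lt ((padic_norm_sub_le_max p _ _).trans_lt (max_lt ?_ ?_)))
  · rw [norm_mul]
    exact mul_lt_one_of_nonneg_of_lt_one_right (hk₁ 0 0) (norm_nonneg _) hd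
  · rw [norm_mul]
    exact mul_lt_one_of_nonneg_of_lt_one_right (hk₁ 0 1) (norm_nonneg _) hc

/-- If `0 ≤ e ≤ n` and `g ∈ GL₂(ℚ_p)` satisfies
`g · a(p^e)⁻¹ ∈ GL₂(ℤ_p)`, then there are `0 ≤ ℓ ≤ n` and `ν ∈ ℤ_p^×` such that either
`ℓ ≤ e` and `g ∈ Z N g_{-e,ℓ,ν} K^{(1)}(p^n)`, or `e < ℓ ≤ n` and
`g ∈ Z N g_{-2ℓ+e,ℓ,ν} K^{(1)}(p^n)`. -/
theorem coset_of_translate (p : ℕ) [Fact p.Prime] (n e : ℕ) (he : e ≤ n)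
    (g : Matrix (Fin 2) (Fin 2) ℚ_[p]) (hg : IsUnit g.det)
    (hge : InGL2Zp p (g * (amat p ((p : ℚ_[p]) ^ (e : ℕ)))⁻¹)) :
    ∃ (ℓ : ℕ) (ν : ℤ_[p]ˣ), ℓ ≤ n ∧
      ((ℓ ≤ e ∧ ∃ (y x : ℚ_[p]) (κ : Matrix (Fin 2) (Fin 2) ℚ_[p]),
          y ≠ 0 ∧ K1 p n κ ∧
            g = zmat p y * nmat p x * gcoset p (-(e : ℤ)) ℓ ν * κ) ∨
       (e < ℓ ∧ ∃ (y x : ℚ_[p]) (κ : Matrix (Fin 2) (Fin 2) ℚ_[p]),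
          y ≠ 0 ∧ K1 p n κ ∧
            g = zmat p y * nmat p x * gcoset p (-2 * (ℓ : ℤ) + (e : ℤ)) ℓ ν * κ)) := by
  have hp : (p : ℚ_[p]) ≠ 0 := by exact_mod_cast (Fact.out : p.Prime).ne_zero
  have hp' : (p : ℝ) ≠ 0 := by exact_mod_cast (Fact.out : p.Prime).ne_zero
  have hp₁ : (1 : ℝ) < p := by exact_mod_cast (Fact.out : p.Prime).one_lt
  have hdetA : (amat p ((p : ℚ_[p]) ^ (e : ℕ))).det = (p : ℚ_[p]) ^ e := by
    simp [amat, det_fin_two]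
  set k := g * (amat p ((p : ℚ_[p]) ^ (e : ℕ)))⁻¹ with hk
  have hgk : g = k * amat p ((p : ℚ_[p]) ^ (e : ℕ)) := by
    rw [hk, Matrix.mul_assoc, Matrix.nonsing_inv_mul _ (by
      rw [hdetA]; exact (pow_ne_zero _ hp).isUnit), Matrix.mul_one]
  have hnorm_pow : ‖(p : ℚ_[p]) ^ e‖ = (p : ℝ) ^ (-(e : ℤ)) := by
    rw [← zpow_natCast, Padic.norm_p_zpow]
  have hdet : ‖g.det‖ = (p : ℝ) ^ (-(e : ℤ)) := by
    rw [hgk, det_mul, hdetA, norm_mul, hge.2, one_mul, hnorm_pow]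
  have hr : ‖g 1 0‖ = ‖k 1 0‖ * (p : ℝ) ^ (-(e : ℤ)) := by
    rw [← hnorm_pow, ← norm_mul, hgk]
    simp [amat, Matrix.mul_apply, Fin.sum_univ_two]
  have hs : g 1 1 = k 1 1 := by
    rw [hgk]
    simp [amat, Matrix.mul_apply, Fin.sum_univ_two]
  rcases (hge.1 1 0).lt_or_eq with hc | hc
  · have hs₁ : ‖g 1 1‖ = 1 := by rw [hs]; exact norm_bottom_right_eq_one p hge hc
    by_cases hrn : ‖g 1 0‖ ≤ (p : ℝ) ^ (-(n : ℤ))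
    · obtain ⟨ν, h⟩ := exists_unit_decomp_of_norm_le p n e g hdet hrn hs₁
      refine ⟨n, ν, le_rfl, ?_⟩
      rcases he.lt_or_eq with h_lt | rfl
      · exact Or.inr ⟨h_lt, h⟩
      · rw [show -2 * (e : ℤ) + e = -e by ring] at h
        exact Or.inl ⟨le_rfl, h⟩
    · have hr₀ : g 1 0 ≠ 0 := fun h₀ => hrn (by rw [h₀, norm_zero]; positivity)
      have hr_lt : ‖g 1 0‖ < (p : ℝ) ^ (-(e : ℤ)) := by
        rw [hr]
        exact mul_lt_of_lt_one_left (by positivity) hc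
      obtain ⟨ℓ, hℓ⟩ := exists_nat_norm_eq_zpow_neg p hr₀
        (hr_lt.le.trans (zpow_le_one_of_nonpos₀ hp₁.le (by simp)))
      rw [hℓ, zpow_lt_zpow_iff_right₀ hp₁] at hr_lt
      rw [hℓ, not_le, zpow_lt_zpow_iff_right₀ hp₁] at hrn
      obtain ⟨ν, h⟩ := exists_unit_decomp_of_norm p n ℓ (-2 * (ℓ : ℤ) + (e : ℤ)) g hr₀
        (by
          rw [hdet, hℓ, ← zpow_natCast, ← _root_.zpow_mul, ← zpow_add₀ hp']
          congr 1
          push_cast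
          ring)
        (by rw [hs₁, hℓ, ← zpow_add₀ hp', neg_add_cancel, zpow_zero])
      exact ⟨ℓ, ν, by lia, Or.inr ⟨by lia, h⟩⟩
  · rw [hc, one_mul] at hr
    have hr₀ : g 1 0 ≠ 0 := by
      rw [← norm_ne_zero_iff, hr]
      exact zpow_ne_zero _ hp'
    have hdet' : ‖g.det‖ = ‖g 1 0‖ ^ 2 * (p : ℝ) ^ (-(-(e : ℤ))) := by
      rw [hdet, hr, ← zpow_natCast, ← _root_.zpow_mul, ← zpow_add₀ hp']
      congr 1
      push_cast
      ring
    by_cases hse : ‖g 1 1‖ ≤ (p : ℝ) ^ (-(e : ℤ))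
    · have hm := zpow_ne_zero (-(e : ℤ)) hp
      have hu : ‖g.det / (g 1 0 ^ 2 * (p : ℚ_[p]) ^ (-(e : ℤ)))‖ = 1 := by
        rw [norm_div, norm_mul, norm_pow, Padic.norm_p_zpow, ← hdet']
        exact div_self (norm_ne_zero_iff.mpr hg.ne_zero)
      refine ⟨0, 1, Nat.zero_le n, Or.inl ⟨Nat.zero_le e, exists_decomp_of_upper p n 0 _ 1 g
        hg.ne_zero hr₀ hu (by field_simp) ((padic_norm_sub_le_max p _ _).trans (max_le ?_ ?_))⟩⟩
      · rw [norm_div, hr]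
        exact div_le_one_of_le₀ hse (by positivity)
      · rw [norm_mul, hu]
        simp
    · have hs₀ : g 1 1 ≠ 0 := fun h₀ => hse (by rw [h₀, norm_zero]; positivity)
      obtain ⟨j, hj⟩ := exists_nat_norm_eq_zpow_neg p hs₀ (by rw [hs]; exact hge.1 1 1)
      rw [hj, not_le, zpow_lt_zpow_iff_right₀ hp₁] at hse
      obtain ⟨ν, h⟩ := exists_unit_decomp_of_norm p n (e - j) (-(e : ℤ)) g hr₀ hdet' (by
        rw [hj, hr, ← zpow_add₀ hp']
        congr 1
        lia)
      exact ⟨e - j, ν, by lia, Or.inl ⟨by lia, h⟩⟩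

end
end

section
/- Let n and e be integers with 0 ≤ e ≤ n, and let g ∈ GL₂(ℚ_p) be such that g·a(p^e)^{−1} ∈ GL₂(ℤ_p). Suppose that for some m ∈ ℤ, some integer ℓ with 0 ≤ ℓ ≤ n, and some ν ∈ ℤ_p^×, one has g ∈ Z·N·g_{m,ℓ,ν}·K^{(1)}(p^n). Then: if ℓ ≤ e, necessarily m = −e; and if ℓ > e, necessarily m = −2ℓ + e. -/
noncomputable section

open Matrix

/-- The open unit ball of `ℚ_p` is closed under subtraction. -/
lemma norm_sub_lt_one {p : ℕ} [Fact p.Prime] {u v : ℚ_[p]} (hu : ‖u‖ < 1) (hv : ‖v‖ < 1) :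
    ‖u - v‖ < 1 := by
  rw [sub_eq_add_neg]
  exact (IsUltrametricDist.norm_add_le_max u (-v)).trans_lt (max_lt hu (by rwa [norm_neg]))

/-- In a matrix of `GL₂(ℤ_p)` the bottom row is unimodular. -/
lemma InGL2Zp.bottom_row {p : ℕ} [Fact p.Prime] {k : Matrix (Fin 2) (Fin 2) ℚ_[p]}
    (hk : InGL2Zp p k) : ‖k 1 0‖ = 1 ∨ ‖k 1 1‖ = 1 := by
  obtain ⟨hi, hd⟩ := hk
  by_contra! h
  have h0 := lt_of_le_of_ne (hi 1 0) h.1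
  have h1 := lt_of_le_of_ne (hi 1 1) h.2
  refine (norm_sub_lt_one (p := p) (u := k 0 0 * k 1 1) (v := k 0 1 * k 1 0) ?_ ?_).ne ?_
  · rw [norm_mul]
    exact (mul_le_of_le_one_left (norm_nonneg _) (hi 0 0)).trans_lt h1
  · rw [norm_mul]
    exact (mul_le_of_le_one_left (norm_nonneg _) (hi 0 1)).trans_lt h0
  · rw [← det_fin_two, hd]

/-- For `κ ∈ K^{(1)}(p^n)` and `‖t‖ = p^ℓ`, the bottom row of `w n(t) κ a(p^e)⁻¹`
has sup norm `p^{max(e, ℓ)}`. -/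
lemma K1.row_norm {p : ℕ} [Fact p.Prime] {n e ℓ : ℕ} (he : e ≤ n) (hℓ : ℓ ≤ n)
    {κ : Matrix (Fin 2) (Fin 2) ℚ_[p]} (hκ : K1 p n κ) {t : ℚ_[p]} (ht : ‖t‖ = (p : ℝ) ^ ℓ) :
    max ((p : ℝ) ^ e * ‖κ 0 0 + t * κ 1 0‖) ‖κ 0 1 + t * κ 1 1‖ = (p : ℝ) ^ max e ℓ := by
  obtain ⟨⟨hi, hd⟩, -, hc⟩ := hκ
  have hp : (1 : ℝ) < p := by exact_mod_cast (Fact.out : p.Prime).one_lt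
  have hp0 : (0 : ℝ) < p := by linarith
  have hmono {i j : ℕ} (h : i ≤ j) : (p : ℝ) ^ i ≤ (p : ℝ) ^ j := pow_le_pow_right₀ hp.le h
  have hcn {i : ℕ} (h : i ≤ n) : (p : ℝ) ^ i * ‖κ 1 0‖ ≤ 1 := by
    calc (p : ℝ) ^ i * ‖κ 1 0‖ ≤ (p : ℝ) ^ n * (p : ℝ) ^ (-(n : ℤ)) :=
          mul_le_mul (hmono h) hc (norm_nonneg _) (by positivity)
      _ = 1 := by rw [_root_.zpow_neg, zpow_natCast]; exact mul_inv_cancel₀ (by positivity)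
  have hA : ‖κ 0 0 + t * κ 1 0‖ ≤ 1 := by
    refine (IsUltrametricDist.norm_add_le_max _ _).trans (max_le (hi 0 0) ?_)
    rw [norm_mul, ht]
    exact hcn hℓ
  have htd : ‖t * κ 1 1‖ ≤ (p : ℝ) ^ ℓ := by
    rw [norm_mul, ht]
    exact mul_le_of_le_one_right (by positivity) (hi 1 1)
  have hB : ‖κ 0 1 + t * κ 1 1‖ ≤ (p : ℝ) ^ ℓ :=
    (IsUltrametricDist.norm_add_le_max _ _).trans
      (max_le ((hi 0 1).trans (one_le_pow₀ hp.le)) htd)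
  apply le_antisymm
  · exact max_le ((mul_le_of_le_one_right (by positivity) hA).trans (hmono (le_max_left _ _)))
      (hB.trans (hmono (le_max_right _ _)))
  by_contra! h
  obtain ⟨h1, h2⟩ := max_lt_iff.1 h
  rcases le_or_gt ℓ e with hle | hlt
  · rw [max_eq_left hle] at h1 h2
    refine (norm_sub_lt_one (p := p) (u := (κ 0 0 + t * κ 1 0) * κ 1 1)
      (v := (κ 0 1 + t * κ 1 1) * κ 1 0) ?_ ?_).ne ?_
    · rw [norm_mul]
      refine (mul_le_of_le_one_right (norm_nonneg _) (hi 1 1)).trans_lt ?_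
      exact (mul_lt_iff_lt_one_right (by positivity)).1 h1
    · rw [norm_mul]
      rcases (norm_nonneg (κ 1 0)).eq_or_lt with h0 | h0
      · rw [← h0]; simp
      · exact (mul_lt_mul_of_pos_right h2 h0).trans_le (hcn he)
    · rw [← hd, det_fin_two]
      congr 1
      ring
  · rw [max_eq_right hlt.le] at h2
    have hd1 : ‖κ 1 1‖ = 1 := by
      refine (hi 1 1).antisymm ?_
      by_contra! hlt1
      refine (norm_sub_lt_one (p := p) (u := κ 0 0 * κ 1 1) (v := κ 0 1 * κ 1 0) ?_ ?_).ne ?_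
      · rw [norm_mul]
        exact (mul_le_of_le_one_left (norm_nonneg _) (hi 0 0)).trans_lt hlt1
      · rw [norm_mul]
        refine (mul_le_of_le_one_left (norm_nonneg _) (hi 0 1)).trans_lt (hc.trans_lt ?_)
        exact zpow_lt_one_of_neg₀ hp (by omega)
      · rw [← det_fin_two, hd]
    have h3 : ‖t * κ 1 1‖ = (p : ℝ) ^ ℓ := by rw [norm_mul, ht, hd1, mul_one]
    have h4 : ‖κ 0 1‖ < (p : ℝ) ^ ℓ := (hi 0 1).trans_lt (one_lt_pow₀ hp (by omega))
    have h5 := IsUltrametricDist.norm_add_le_max (κ 0 1 + t * κ 1 1) (-κ 0 1)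
    rw [add_neg_cancel_comm, norm_neg, h3] at h5
    exact (h5.trans_lt (max_lt h2 h4)).false

/-- Let `0 ≤ e ≤ n` and let `g ∈ GL₂(ℚ_p)` satisfy
`g · a(p^e)⁻¹ ∈ GL₂(ℤ_p)`. If `g ∈ Z N g_{m,ℓ,ν} K^{(1)}(p^n)` for some `m ∈ ℤ`,
`0 ≤ ℓ ≤ n` and `ν ∈ ℤ_p^×`, then `m = -e` whenever `ℓ ≤ e`, and `m = -2ℓ + e` whenever
`ℓ > e`. -/
theorem coset_exponent_determined (p : ℕ) [Fact p.Prime] (n e : ℕ) (he : e ≤ n)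
    (g : Matrix (Fin 2) (Fin 2) ℚ_[p]) (hg : IsUnit g.det)
    (hge : InGL2Zp p (g * (amat p ((p : ℚ_[p]) ^ (e : ℕ)))⁻¹))
    (m : ℤ) (ℓ : ℕ) (hℓ : ℓ ≤ n) (ν : ℤ_[p]ˣ)
    (hcoset : ∃ (y x : ℚ_[p]) (κ : Matrix (Fin 2) (Fin 2) ℚ_[p]),
      y ≠ 0 ∧ K1 p n κ ∧ g = zmat p y * nmat p x * gcoset p m ℓ ν * κ) :
    (ℓ ≤ e → m = -(e : ℤ)) ∧ (e < ℓ → m = -2 * (ℓ : ℤ) + (e : ℤ)) := by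
  obtain ⟨y, x, κ, hy, hκ, hgκ⟩ := hcoset
  have hp : (1 : ℝ) < p := by exact_mod_cast (Fact.out : p.Prime).one_lt
  have hp0 : (0 : ℝ) < p := by linarith
  have hpQ : (p : ℚ_[p]) ≠ 0 := by exact_mod_cast (Fact.out : p.Prime).ne_zero
  set t : ℚ_[p] := (p : ℚ_[p]) ^ (-(ℓ : ℤ)) * ((ν : ℤ_[p]) : ℚ_[p]) with ht
  have htn : ‖t‖ = (p : ℝ) ^ ℓ := by
    rw [ht, norm_mul, Padic.norm_p_zpow, neg_neg, zpow_natCast, ← PadicInt.norm_def,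
      PadicInt.norm_units, mul_one]
  set k := g * (amat p ((p : ℚ_[p]) ^ e))⁻¹ with hk
  have hgk : g = k * amat p ((p : ℚ_[p]) ^ e) := by
    rw [hk, Matrix.mul_assoc, nonsing_inv_mul, Matrix.mul_one]
    simp [amat, det_fin_two, hpQ]
  have e0 : k 1 0 * (p : ℚ_[p]) ^ e = -(y * (κ 0 0 + t * κ 1 0)) := by
    have h := congrFun (congrFun (hgk.symm.trans hgκ) 1) 0
    simp [amat, zmat, nmat, gcoset, wmat, Matrix.mul_apply, Fin.sum_univ_two] at h
    rw [h, ht, _root_.zpow_neg, zpow_natCast]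
    ring
  have e1 : k 1 1 = -(y * (κ 0 1 + t * κ 1 1)) := by
    have h := congrFun (congrFun (hgk.symm.trans hgκ) 1) 1
    simp [amat, zmat, nmat, gcoset, wmat, Matrix.mul_apply, Fin.sum_univ_two] at h
    rw [h, ht, _root_.zpow_neg, zpow_natCast]
    ring
  have e2 : k.det * (p : ℚ_[p]) ^ (e : ℤ) = y ^ 2 * (p : ℚ_[p]) ^ m * κ.det := by
    have h := congrArg det (hgk.symm.trans hgκ)
    simp only [gcoset, det_mul] at h
    simp [amat, zmat, nmat, wmat, det_fin_two_of] at h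
    rw [zpow_natCast, h]
    ring
  have n0 : ‖k 1 0‖ = ‖y‖ * ((p : ℝ) ^ e * ‖κ 0 0 + t * κ 1 0‖) := by
    have h := congrArg norm e0
    rw [norm_mul, norm_neg, norm_mul, norm_pow, Padic.norm_p, inv_pow,
      mul_inv_eq_iff_eq_mul₀ (by positivity)] at h
    rw [h]
    ring
  have n1 : ‖k 1 1‖ = ‖y‖ * ‖κ 0 1 + t * κ 1 1‖ := by rw [e1, norm_neg, norm_mul]
  have n2 : (p : ℝ) ^ (-(e : ℤ)) = ‖y‖ ^ 2 * (p : ℝ) ^ (-m) := by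
    have h := congrArg norm e2
    rwa [norm_mul, norm_mul, norm_mul, hge.2, hκ.1.2, norm_pow, Padic.norm_p_zpow,
      Padic.norm_p_zpow, one_mul, mul_one] at h
  have hmax : max ‖k 1 0‖ ‖k 1 1‖ = 1 := by
    refine le_antisymm (max_le (hge.1 1 0) (hge.1 1 1)) ?_
    rcases hge.bottom_row with h | h
    · exact h.ge.trans (le_max_left _ _)
    · exact h.ge.trans (le_max_right _ _)
  rw [n0, n1, ← mul_max_of_nonneg _ _ (norm_nonneg y), hκ.row_norm he hℓ htn] at hmax
  have hyn : ‖y‖ = (p : ℝ) ^ (-((max e ℓ : ℕ) : ℤ)) := by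
    rw [_root_.zpow_neg, zpow_natCast]
    exact eq_inv_of_mul_eq_one_left hmax
  rw [hyn, ← zpow_natCast, ← _root_.zpow_mul, ← zpow_add₀ hp0.ne'] at n2
  have key := zpow_right_injective₀ hp0 hp.ne' n2
  push_cast at key
  omega

end
end

section
/- For every real δ with 0 ≤ δ < 1/2 and every real ε with 0 < ε < 1, there exists a constant C > 0 (depending only on δ and ε) with the following property: for every integer L ≥ 1, every integer t with 1 ≤ t ≤ L, and every real α > 0, one has Σ_{j ∈ ℤ, t + jL ≠ 0} |t + jL|^{−1/2 + δ + ε} · (α·|t + jL|/L)^{−ε} · exp((−2π + ε)·α·|t + jL|/L) ≤ C·(L/α)^{ε}·(1 + (Lα)^{−1/2}·(L/α)^{δ + ε}). -/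
open scoped BigOperators

open MeasureTheory Set in
/-- A sum of samples of `x ^ (-β) * exp (-a x)` at the positive integers is bounded by its
integral over the half-line. -/
lemma tsum_rpow_mul_exp_neg_le {β a : ℝ} (hβ0 : 0 ≤ β) (hβ1 : β < 1) (ha : 0 < a) :
    ∑' k : ℕ, ENNReal.ofReal (((k : ℝ) + 1) ^ (-β) * Real.exp (-(a * ((k : ℝ) + 1))))
      ≤ ENNReal.ofReal ((1 / a) ^ (1 - β) * Real.Gamma (1 - β)) := by
  set f : ℝ → ℝ := fun x => x ^ (-β) * Real.exp (-(a * x)) with hf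
  have hint : ∫ x in Ioi 0, f x = (1 / a) ^ (1 - β) * Real.Gamma (1 - β) := by
    rw [← Real.integral_rpow_mul_exp_neg_mul_Ioi (sub_pos.2 hβ1) ha]
    simp only [hf, sub_sub_cancel_left]
  have hpos : 0 < (1 / a) ^ (1 - β) * Real.Gamma (1 - β) :=
    mul_pos (Real.rpow_pos_of_pos (by positivity) _) (Real.Gamma_pos_of_pos (sub_pos.2 hβ1))
  have hfi : IntegrableOn f (Ioi 0) := by
    by_contra h
    rw [integral_undef h] at hint
    exact hpos.ne hint
  rw [← hint, ofReal_integral_eq_lintegral_ofReal hfi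
    ((ae_restrict_mem measurableSet_Ioi).mono fun x hx =>
      mul_nonneg (Real.rpow_nonneg (le_of_lt hx) _) (Real.exp_pos _).le)]
  have hdisj : Pairwise (Function.onFun Disjoint fun k : ℕ => Ioc (k : ℝ) (k + 1)) := by
    intro i j hij
    simpa [Function.onFun] using
      pairwise_disjoint_Ioc_intCast ℝ (Int.ofNat_injective.ne hij)
  calc _ ≤ ∑' k : ℕ, ∫⁻ x in Ioc (k : ℝ) (k + 1), ENNReal.ofReal (f x) := by
        refine ENNReal.tsum_le_tsum fun k => ?_
        calc _ = ∫⁻ _ in Ioc (k : ℝ) (k + 1), ENNReal.ofReal (f (k + 1)) := by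
              simp [hf]
          _ ≤ _ := by
              refine setLIntegral_mono' measurableSet_Ioc fun x hx => ?_
              have hx0 : 0 < x := k.cast_nonneg.trans_lt hx.1
              refine ENNReal.ofReal_le_ofReal ?_
              refine mul_le_mul (Real.rpow_le_rpow_of_nonpos hx0 hx.2 (by linarith)) ?_
                (Real.exp_pos _).le (Real.rpow_nonneg hx0.le _)
              exact Real.exp_le_exp.2 (neg_le_neg (mul_le_mul_of_nonneg_left hx.2 ha.le))
    _ = ∫⁻ x in ⋃ k : ℕ, Ioc (k : ℝ) (k + 1), ENNReal.ofReal (f x) :=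
        (lintegral_iUnion (fun _ => measurableSet_Ioc) hdisj _).symm
    _ ≤ _ := lintegral_mono_set (iUnion_subset fun k x hx => k.cast_nonneg.trans_lt hx.1)

/-- A sum over a residue class modulo `L` with one term in each interval `[k L, ∞)`. -/
lemma tsum_le_of_natCast_mul_le {β α : ℝ} (hβ0 : 0 ≤ β) (hβ1 : β < 1) (hα : 0 < α) {L : ℤ}
    (hL : 1 ≤ L) (m : ℕ → ℤ) (hm : ∀ k : ℕ, k * L ≤ |m k|) :
    ∑' k : ℕ, ENNReal.ofReal (if m k = 0 then 0 else
        |(m k : ℝ)| ^ (-β) * Real.exp (-(α * |(m k : ℝ)| / L)))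
      ≤ ENNReal.ofReal (1 + (L : ℝ) ^ (-β) * ((1 / α) ^ (1 - β) * Real.Gamma (1 - β))) := by
  have hL0 : (0 : ℝ) < L := by exact_mod_cast hL
  have hΓ : 0 < Real.Gamma (1 - β) := Real.Gamma_pos_of_pos (sub_pos.2 hβ1)
  rw [tsum_eq_zero_add' ENNReal.summable, ENNReal.ofReal_add zero_le_one (by positivity),
    ENNReal.ofReal_mul (by positivity)]
  refine add_le_add (ENNReal.ofReal_le_ofReal ?_) ((ENNReal.tsum_le_tsum fun k => ?_).trans
    ((ENNReal.tsum_mul_left).le.trans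
      (mul_le_mul_right (tsum_rpow_mul_exp_neg_le hβ0 hβ1 hα) _)))
  · split_ifs with h
    · exact zero_le_one
    · have h1 : (1 : ℝ) ≤ |(m 0 : ℝ)| := by exact_mod_cast Int.one_le_abs h
      refine mul_le_one₀ (Real.rpow_le_one_of_one_le_of_nonpos h1 (by linarith))
        (Real.exp_pos _).le (Real.exp_le_one_iff.2 (neg_nonpos.2 (by positivity)))
  · rw [← ENNReal.ofReal_mul (by positivity)]
    refine ENNReal.ofReal_le_ofReal ?_
    split_ifs with h
    · positivity
    · have h1 : ((k : ℝ) + 1) * L ≤ |(m (k + 1) : ℝ)| := by exact_mod_cast hm (k + 1)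
      rw [← mul_assoc, ← Real.mul_rpow hL0.le (by positivity)]
      refine mul_le_mul (Real.rpow_le_rpow_of_nonpos (by positivity) (by linarith) (by linarith))
        (Real.exp_le_exp.2 (neg_le_neg ?_)) (Real.exp_pos _).le (by positivity)
      rw [le_div_iff₀ hL0, mul_assoc]
      exact mul_le_mul_of_nonneg_left h1 hα.le

lemma rpow_mul_rpow_neg_mul_exp_le {δ ε n L α : ℝ} (hε1 : ε < 1) (hn : 0 < n) (hL : 0 < L)
    (hα : 0 < α) :
    n ^ (-1 / 2 + δ + ε) * (α * n / L) ^ (-ε) * Real.exp ((-2 * Real.pi + ε) * α * n / L)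
      ≤ (L / α) ^ ε * (n ^ (-(1 / 2 - δ)) * Real.exp (-(α * n / L))) := by
  have h1 : (α * n / L) ^ (-ε) = (L / α) ^ ε * n ^ (-ε) := by
    rw [show α * n / L = (L / α)⁻¹ * n by field_simp, Real.mul_rpow (by positivity) hn.le,
      Real.inv_rpow (by positivity), Real.rpow_neg (by positivity), inv_inv]
  have h2 : n ^ (-(1 / 2 - δ)) = n ^ (-1 / 2 + δ + ε) * n ^ (-ε) := by
    rw [← Real.rpow_add hn]
    ring_nf
  rw [h1, h2, mul_left_comm, mul_assoc]
  refine mul_le_mul_of_nonneg_left (mul_le_mul_of_nonneg_left (Real.exp_le_exp.2 ?_)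
    (by positivity)) (by positivity)
  have h3 : 0 < α * n / L := by positivity
  have h4 : (-2 * Real.pi + ε) * α * n / L = (-2 * Real.pi + ε) * (α * n / L) := by ring
  rw [h4]
  nlinarith [Real.pi_gt_three]

/-- Shrinking `L ^ (-β) α ^ (β - 1)` by the factor `(L / α) ^ ε` only matters when `α > L`, where
it is at most `1`. -/
lemma rpow_mul_one_div_rpow_le {δ ε L α : ℝ} (hδ0 : 0 ≤ δ) (hδ1 : δ < 1 / 2) (hε0 : 0 < ε)
    (hL : 1 ≤ L) (hα : 0 < α) :
    L ^ (-(1 / 2 - δ)) * (1 / α) ^ (1 - (1 / 2 - δ))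
      ≤ 1 + (L * α) ^ (-(1 : ℝ) / 2) * (L / α) ^ (δ + ε) := by
  have hL0 : 0 < L := by linarith
  have hY : 0 ≤ (L * α) ^ (-(1 : ℝ) / 2) * (L / α) ^ (δ + ε) := by positivity
  rcases le_total α L with h | h
  · have key : (L * α) ^ (-(1 : ℝ) / 2) * (L / α) ^ (δ + ε)
        = L ^ (-(1 / 2 - δ)) * (1 / α) ^ (1 - (1 / 2 - δ)) * (L / α) ^ ε := by
      rw [Real.rpow_add (by positivity), ← mul_assoc]
      congr 1
      rw [one_div α, Real.inv_rpow hα.le, ← Real.rpow_neg hα.le, Real.mul_rpow hL0.le hα.le,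
        div_eq_mul_inv L, Real.mul_rpow hL0.le (by positivity), Real.inv_rpow hα.le,
        ← Real.rpow_neg hα.le, mul_mul_mul_comm, ← Real.rpow_add hL0, ← Real.rpow_add hα]
      ring_nf
    have h1 : 1 ≤ (L / α) ^ ε := Real.one_le_rpow ((one_le_div hα).2 h) hε0.le
    have h2 : 0 ≤ L ^ (-(1 / 2 - δ)) * (1 / α) ^ (1 - (1 / 2 - δ)) := by positivity
    rw [key]
    nlinarith
  · have h1 : L ^ (-(1 / 2 - δ)) * (1 / α) ^ (1 - (1 / 2 - δ)) ≤ 1 :=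
      mul_le_one₀ (Real.rpow_le_one_of_one_le_of_nonpos hL (by linarith)) (by positivity)
        (Real.rpow_le_one (by positivity) ((div_le_one hα).2 (hL.trans h)) (by linarith))
    linarith

/-- For `0 ≤ δ < 1/2` and `0 < ε < 1` there is a constant `C > 0` such
that for every integer `L ≥ 1`, every integer `t` with `1 ≤ t ≤ L` and every real
`α > 0`,
`Σ_{j ∈ ℤ, t+jL ≠ 0} |t+jL|^{-1/2+δ+ε} (α|t+jL|/L)^{-ε} exp((-2π+ε) α |t+jL|/L)
  ≤ C (L/α)^ε (1 + (Lα)^{-1/2} (L/α)^{δ+ε})`. -/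
theorem archimedean_tail_sum (δ ε : ℝ) (hδ0 : 0 ≤ δ) (hδ1 : δ < 1 / 2)
    (hε0 : 0 < ε) (hε1 : ε < 1) :
    ∃ C : ℝ, 0 < C ∧
      ∀ (L : ℤ), 1 ≤ L → ∀ (t : ℤ), 1 ≤ t → t ≤ L → ∀ (α : ℝ), 0 < α →
        (∑' j : ℤ, ENNReal.ofReal
            (if t + j * L = 0 then 0 else
              |((t + j * L : ℤ) : ℝ)| ^ (-1 / 2 + δ + ε) *
                (α * |((t + j * L : ℤ) : ℝ)| / (L : ℝ)) ^ (-ε) *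
                Real.exp ((-2 * Real.pi + ε) * α * |((t + j * L : ℤ) : ℝ)| / (L : ℝ))))
          ≤ ENNReal.ofReal
              (C * ((L : ℝ) / α) ^ ε *
                (1 + ((L : ℝ) * α) ^ (-(1 : ℝ) / 2) * ((L : ℝ) / α) ^ (δ + ε))) := by
  have hΓ : 0 < Real.Gamma (1 - (1 / 2 - δ)) := Real.Gamma_pos_of_pos (by linarith)
  refine ⟨2 * (1 + Real.Gamma (1 - (1 / 2 - δ))), by positivity, ?_⟩
  intro L hL t ht htL α hα
  have hL0 : (0 : ℝ) < L := by exact_mod_cast hL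
  have hL1 : (1 : ℝ) ≤ L := by exact_mod_cast hL
  set G : ℝ := Real.Gamma (1 - (1 / 2 - δ))
  set B : ℝ := 1 + (L : ℝ) ^ (-(1 / 2 - δ)) * ((1 / α) ^ (1 - (1 / 2 - δ)) * G) with hB
  have hB0 : 0 ≤ B := by positivity
  set F : ℤ → ENNReal := fun j => ENNReal.ofReal (if t + j * L = 0 then 0 else
    |((t + j * L : ℤ) : ℝ)| ^ (-(1 / 2 - δ)) *
      Real.exp (-(α * |((t + j * L : ℤ) : ℝ)| / L))) with hF
  have hnonneg : ∑' k : ℕ, F k ≤ ENNReal.ofReal B := by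
    refine tsum_le_of_natCast_mul_le (by linarith) (by linarith) hα hL
      (fun k : ℕ => t + (k : ℤ) * L) fun k => ?_
    exact (by linarith : (k : ℤ) * L ≤ t + k * L).trans (le_abs_self _)
  have hneg : ∑' k : ℕ, F (-(k + 1)) ≤ ENNReal.ofReal B := by
    refine tsum_le_of_natCast_mul_le (by linarith) (by linarith) hα hL
      (fun k : ℕ => t + (-((k : ℤ) + 1)) * L) fun k => ?_
    exact (by linarith : (k : ℤ) * L ≤ -(t + (-((k : ℤ) + 1)) * L)).trans (neg_le_abs _)
  calc _ ≤ ∑' j : ℤ, ENNReal.ofReal (((L : ℝ) / α) ^ ε) * F j := by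
        refine ENNReal.tsum_le_tsum fun j => ?_
        rw [hF, ← ENNReal.ofReal_mul (by positivity)]
        refine ENNReal.ofReal_le_ofReal ?_
        split_ifs with h
        · simp
        · exact rpow_mul_rpow_neg_mul_exp_le hε1 (abs_pos.2 (Int.cast_ne_zero.2 h)) hL0 hα
    _ = ENNReal.ofReal (((L : ℝ) / α) ^ ε) *
          (∑' k : ℕ, F k + ∑' k : ℕ, F (-(k + 1))) := by
        rw [ENNReal.tsum_mul_left,
          tsum_of_nat_of_neg_add_one ENNReal.summable ENNReal.summable]
    _ ≤ ENNReal.ofReal (((L : ℝ) / α) ^ ε) * (ENNReal.ofReal B + ENNReal.ofReal B) := by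
        gcongr
    _ = ENNReal.ofReal (((L : ℝ) / α) ^ ε * (B + B)) := by
        rw [← ENNReal.ofReal_add hB0 hB0, ← ENNReal.ofReal_mul (by positivity)]
    _ ≤ _ := by
        refine ENNReal.ofReal_le_ofReal ?_
        rw [mul_comm (2 * (1 + G)), mul_assoc]
        refine mul_le_mul_of_nonneg_left ?_ (by positivity)
        have h1 := rpow_mul_one_div_rpow_le hδ0 hδ1 hε0 hL1 hα
        have hY : 0 ≤ ((L : ℝ) * α) ^ (-(1 : ℝ) / 2) * ((L : ℝ) / α) ^ (δ + ε) := by positivity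
        rw [hB, ← mul_assoc]
        nlinarith [mul_le_mul_of_nonneg_right h1 hΓ.le]
end
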